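/- arXiv:2509.08016 — 3 statements merged into one kernel-verified Lean document; each statement's English description precedes it below -/
import Mathlib

section
/- Let (Ω, μ) be a probability space and X : Ω → ℝ a measurable random variable. Suppose there is a real δ with 0 ≤ δ ≤ 1/2 such that |X(ω)| ≤ δ for μ-almost every ω, and E[X] = 0. Then |E[-log(1 + X)] - (1/2)·E[X²]| ≤ δ³. -/
open MeasureTheory

/-- Third-order Taylor bound for `log (1 + x)` on `|x| ≤ 1/2`. -/
theorem Real.abs_neg_log_one_add_add_sub_half_sq_le {x : ℝ} (hx : |x| ≤ 1 / 2) :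
    |-Real.log (1 + x) + x - 1 / 2 * x ^ 2| ≤ |x| ^ 3 := by
  have taylor := Real.abs_log_sub_add_sum_range_le (x := -x) (by rw [abs_neg]; linarith) 4
  rw [abs_neg, sub_neg_eq_add] at taylor
  have h0 : 0 ≤ |x| := abs_nonneg x
  have h3 : 0 ≤ |x| ^ 3 := by positivity
  have h4 : |x| ^ 4 ≤ |x| ^ 3 / 2 := by nlinarith
  have h5 : |x| ^ 5 ≤ |x| ^ 3 / 4 := by nlinarith
  have remainder : |x| ^ (4 + 1) / (1 - |x|) ≤ |x| ^ 3 / 2 := by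
    rw [div_le_iff₀ (by linarith)]
    nlinarith
  have cubic : |x ^ 3| = |x| ^ 3 := abs_pow x 3
  have quartic : |x ^ 4| = |x| ^ 4 := abs_pow x 4
  have cubic_bounds := abs_le.mp cubic.le
  have quartic_bounds := abs_le.mp quartic.le
  have taylor_bounds := abs_le.mp (taylor.trans remainder)
  norm_num [Finset.sum_range_succ] at taylor_bounds
  ring_nf at taylor_bounds cubic_bounds quartic_bounds h3 h4 h5 ⊢
  rw [abs_le]
  constructor <;> linarith [taylor_bounds.1, taylor_bounds.2]

/-- On a probability space, if `X` is measurable, `|X| ≤ δ` almost surely with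
`0 ≤ δ ≤ 1/2`, and `E[X] = 0`, then `|E[-log (1 + X)] - (1/2) E[X²]| ≤ δ³`. -/
theorem expectation_neg_log_one_add_sub_half_second_moment
    {Ω : Type*} [MeasurableSpace Ω] (μ : Measure Ω) [IsProbabilityMeasure μ]
    (X : Ω → ℝ) (hX : Measurable X) (δ : ℝ) (hδ0 : 0 ≤ δ) (hδ : δ ≤ 1 / 2)
    (hbound : ∀ᵐ ω ∂μ, |X ω| ≤ δ) (hmean : ∫ ω, X ω ∂μ = 0) :
    |(∫ ω, -Real.log (1 + X ω) ∂μ) - (1 / 2) * ∫ ω, (X ω) ^ 2 ∂μ| ≤ δ ^ 3 := by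
  have hX_int : Integrable X μ := .of_bound hX.aestronglyMeasurable δ hbound
  have hsq_int : Integrable (fun ω => X ω ^ 2) μ := by
    refine .of_bound (hX.pow_const 2).aestronglyMeasurable (δ ^ 2) ?_
    filter_upwards [hbound] with ω hω
    rw [Real.norm_eq_abs, abs_pow]
    gcongr
  have hpointwise : ∀ᵐ ω ∂μ, ‖-Real.log (1 + X ω) + X ω - 1 / 2 * X ω ^ 2‖ ≤ δ ^ 3 := by
    filter_upwards [hbound] with ω hω
    exact (Real.abs_neg_log_one_add_add_sub_half_sq_le (hω.trans hδ)).trans (by gcongr)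
  have herr_int : Integrable (fun ω => -Real.log (1 + X ω) + X ω - 1 / 2 * X ω ^ 2) μ :=
    .of_bound (by fun_prop) (δ ^ 3) hpointwise
  have hlog_int : Integrable (fun ω => -Real.log (1 + X ω)) μ := by
    refine ((herr_int.sub hX_int).add (hsq_int.const_mul (1 / 2))).congr (ae_of_all _ fun ω => ?_)
    simp only [Pi.add_apply, Pi.sub_apply]
    ring
  have herr : ∫ ω, (-Real.log (1 + X ω) + X ω - 1 / 2 * X ω ^ 2) ∂μ =
      (∫ ω, -Real.log (1 + X ω) ∂μ) - (1 / 2) * ∫ ω, (X ω) ^ 2 ∂μ := by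
    have hsum_int : Integrable (fun ω => -Real.log (1 + X ω) + X ω) μ := hlog_int.add hX_int
    rw [integral_sub hsum_int (hsq_int.const_mul _), integral_add hlog_int hX_int,
      integral_const_mul, hmean, add_zero]
  rw [← herr]
  simpa using norm_integral_le_of_norm_le_const hpointwise
end

section
/- (ParScale scaling law, precise form.) Let (Ω, μ) be a probability space, J ≥ 1 a natural number, and X_1, …, X_J : Ω → ℝ measurable random variables. Suppose there is a real δ with 0 ≤ δ ≤ 1/2 such that |X_j(ω)| ≤ δ for μ-almost every ω and every j; that E[X_j] = 0 for every j; that there are reals A > 0, N > 0, α > 0 with E[X_j²] = 2A/N^α for every j; and that there is a real ρ with E[X_j · X_k] = 2Aρ/N^α for all j ≠ k. Then, with X̄ := (1/J)·Σ_{j=1}^J X_j, one has |E[-log(1 + X̄)] - (A / (N·J^{1/α})^α)·(1 + (J - 1)·ρ)| ≤ δ³, where moreover (N·J^{1/α})^α = N^α·J (real powers, with J cast to ℝ). -/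
open MeasureTheory

/-- Second-order Taylor estimate for `-log (1 + y)` with cubic remainder on `[-1/2, 1/2]`. -/
theorem abs_neg_log_one_add_sub_le {y : ℝ} (hy : |y| ≤ 1 / 2) :
    |-Real.log (1 + y) - (y ^ 2 / 2 - y)| ≤ |y| ^ 3 := by
  have h := Real.abs_log_sub_add_sum_range_le (x := -y) (by rw [abs_neg]; linarith) 4
  simp only [Finset.sum_range_succ, Finset.sum_range_zero, abs_neg, sub_neg_eq_add] at h
  norm_num at h
  have h0 := abs_nonneg y
  have h3 : 0 ≤ |y| ^ 3 := by positivity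
  have h4 : |y| ^ 4 ≤ |y| ^ 3 / 2 := by nlinarith
  have hrem : |y| ^ 5 / (1 - |y|) ≤ |y| ^ 3 / 2 := by
    rw [div_le_iff₀ (by linarith)]
    nlinarith
  have hy3 : |y ^ 3| = |y| ^ 3 := abs_pow y 3
  have hy4 : |y ^ 4| = |y| ^ 4 := abs_pow y 4
  have h3' := abs_le.mp hy3.le
  have h4' := abs_le.mp hy4.le
  have h' := abs_le.mp (h.trans hrem)
  rw [abs_le]
  constructor <;> ring_nf at h' h3' h4' h3 h4 ⊢ <;> linarith [h'.1, h'.2, h3'.1, h3'.2, h4'.1, h4'.2]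

theorem abs_average_le {J : ℕ} {δ : ℝ} (hδ : 0 ≤ δ) {x : Fin J → ℝ} (hx : ∀ j, |x j| ≤ δ) :
    |(1 / (J : ℝ)) * ∑ j, x j| ≤ δ := by
  rcases Nat.eq_zero_or_pos J with rfl | hJ
  · simpa using hδ
  have hJ' : (0 : ℝ) < J := by exact_mod_cast hJ
  have hsum : |∑ j, x j| ≤ J * δ := by
    calc |∑ j, x j| ≤ ∑ j, |x j| := Finset.abs_sum_le_sum_abs _ _
      _ ≤ ∑ _j : Fin J, δ := Finset.sum_le_sum fun j _ => hx j
      _ = J * δ := by simp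
  rw [abs_mul, abs_of_pos (by positivity), one_div, inv_mul_le_iff₀ hJ']
  exact hsum

/-- The second moment of a sum of variables with common second moment `v` and common
pairwise cross-moment `c`. -/
theorem integral_sum_sq_of_common_moments {Ω : Type*} [MeasurableSpace Ω] {μ : Measure Ω}
    {J : ℕ} {X : Fin J → Ω → ℝ} (hX : ∀ j k, Integrable (fun ω => X j ω * X k ω) μ) {v c : ℝ}
    (hvar : ∀ j, ∫ ω, (X j ω) ^ 2 ∂μ = v)
    (hcov : ∀ j k, j ≠ k → ∫ ω, X j ω * X k ω ∂μ = c) :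
    ∫ ω, (∑ j, X j ω) ^ 2 ∂μ = J * (v + (J - 1) * c) := by
  have hmoment : ∀ j k, ∫ ω, X j ω * X k ω ∂μ = c + if j = k then v - c else 0 := by
    intro j k
    split_ifs with h
    · subst h
      simp [← hvar j, pow_two]
    · rw [hcov j k h, add_zero]
  simp_rw [pow_two, Finset.sum_mul_sum]
  rw [integral_finsetSum _ fun j _ => integrable_finsetSum _ fun k _ => hX j k]
  simp_rw [integral_finsetSum _ fun k _ => hX _ k, hmoment, Finset.sum_add_distrib]
  simp
  ring

/-- ParScale scaling law (precise form).  If the per-stream relative errors `X_j`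
are a.s. bounded by `δ ≤ 1/2`, have zero mean, common second moment `2A/N^α`
and common pairwise cross-moment `2Aρ/N^α`, then the excess cross-entropy of the
`J`-stream ensemble `X̄ = (1/J) Σ_j X_j` satisfies
`|E[-log (1 + X̄)] - (A/(N J^{1/α})^α)(1 + (J - 1)ρ)| ≤ δ³`, and moreover
`(N J^{1/α})^α = N^α J`. -/
theorem parscale_scaling_law
    {Ω : Type*} [MeasurableSpace Ω] (μ : Measure Ω) [IsProbabilityMeasure μ]
    (J : ℕ) (hJ : 1 ≤ J) (X : Fin J → Ω → ℝ) (hmeas : ∀ j, Measurable (X j))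
    (δ : ℝ) (hδ0 : 0 ≤ δ) (hδ : δ ≤ 1 / 2)
    (hbound : ∀ j, ∀ᵐ ω ∂μ, |X j ω| ≤ δ)
    (hmean : ∀ j, ∫ ω, X j ω ∂μ = 0)
    (A N α : ℝ) (hA : 0 < A) (hN : 0 < N) (hα : 0 < α)
    (hvar : ∀ j, ∫ ω, (X j ω) ^ 2 ∂μ = 2 * A / N ^ α)
    (ρ : ℝ) (hcov : ∀ j k, j ≠ k → ∫ ω, X j ω * X k ω ∂μ = 2 * A * ρ / N ^ α) :
    |(∫ ω, -Real.log (1 + (1 / (J : ℝ)) * ∑ j, X j ω) ∂μ)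
        - (A / (N * (J : ℝ) ^ (1 / α)) ^ α) * (1 + ((J : ℝ) - 1) * ρ)| ≤ δ ^ 3
      ∧ (N * (J : ℝ) ^ (1 / α)) ^ α = N ^ α * (J : ℝ) := by
  have hJ0 : (0 : ℝ) < J := by exact_mod_cast hJ
  have hNα : 0 < N ^ α := Real.rpow_pos_of_pos hN α
  have hpow : (N * (J : ℝ) ^ (1 / α)) ^ α = N ^ α * (J : ℝ) := by
    rw [Real.mul_rpow hN.le (by positivity), ← Real.rpow_mul hJ0.le, one_div_mul_cancel hα.ne',
      Real.rpow_one]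
  refine ⟨?_, hpow⟩
  have hint : ∀ j, Integrable (X j) μ := fun j =>
    Integrable.of_bound (hmeas j).aestronglyMeasurable δ (hbound j)
  have hint2 : ∀ j k, Integrable (fun ω => X j ω * X k ω) μ := fun j k =>
    (hint k).bdd_mul (hmeas j).aestronglyMeasurable (hbound j)
  set Y : Ω → ℝ := fun ω => (1 / (J : ℝ)) * ∑ j, X j ω with hY
  have hYmeas : Measurable Y :=
    (Finset.measurable_fun_sum _ fun j _ => hmeas j).const_mul _
  have hYbound : ∀ᵐ ω ∂μ, |Y ω| ≤ δ := by
    filter_upwards [ae_all_iff.mpr hbound] with ω hω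
    exact abs_average_le hδ0 hω
  have hYint : Integrable Y μ := (integrable_finsetSum _ fun j _ => hint j).const_mul _
  have hY2int : Integrable (fun ω => Y ω ^ 2) μ := by
    simp_rw [pow_two]
    exact hYint.bdd_mul hYmeas.aestronglyMeasurable hYbound
  have hYmean : ∫ ω, Y ω ∂μ = 0 := by
    rw [hY, integral_const_mul, integral_finsetSum _ fun j _ => hint j]
    simp [hmean]
  have hY2mean : ∫ ω, Y ω ^ 2 ∂μ
      = (1 / (J : ℝ)) ^ 2 * (J * (2 * A / N ^ α + (J - 1) * (2 * A * ρ / N ^ α))) := by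
    simp_rw [hY, mul_pow]
    rw [integral_const_mul, integral_sum_sq_of_common_moments hint2 hvar hcov]
  have hquad : Integrable (fun ω => Y ω ^ 2 / 2 - Y ω) μ := (hY2int.div_const 2).sub hYint
  have hrem : ∀ᵐ ω ∂μ, ‖-Real.log (1 + Y ω) - (Y ω ^ 2 / 2 - Y ω)‖ ≤ δ ^ 3 := by
    filter_upwards [hYbound] with ω hω
    exact (abs_neg_log_one_add_sub_le (hω.trans hδ)).trans
      (pow_le_pow_left₀ (abs_nonneg _) hω 3)
  have hremint : Integrable (fun ω => -Real.log (1 + Y ω) - (Y ω ^ 2 / 2 - Y ω)) μ :=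
    Integrable.of_bound (by fun_prop) (δ ^ 3) hrem
  have hlogint : Integrable (fun ω => -Real.log (1 + Y ω)) μ := by
    refine (hremint.add hquad).congr (.of_forall fun ω => ?_)
    simp
  have hmain : (A / (N * (J : ℝ) ^ (1 / α)) ^ α) * (1 + ((J : ℝ) - 1) * ρ)
      = ∫ ω, (Y ω ^ 2 / 2 - Y ω) ∂μ := by
    rw [integral_sub (hY2int.div_const 2) hYint, integral_div, hYmean, hY2mean, hpow]
    field_simp
    ring
  rw [hmain, ← integral_sub hlogint hquad]
  simpa using norm_integral_le_of_norm_le_const hrem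
end

section
/- (VPS scaling law, precise form.) Let (Ω, μ) be a probability space, J ≥ 1 a natural number, and X_1, …, X_J : Ω → ℝ measurable random variables with |X_j(ω)| ≤ δ for μ-almost every ω and every j, where 0 ≤ δ ≤ 1/2. Define the biases B_j := -E[X_j] and the centered residuals ε_j := X_j + B_j. Suppose there is a real V ≥ 0 with E[ε_j²] = 2V for every j, and a real ρ with E[ε_j · ε_k] = 2Vρ for all j ≠ k. Then, with X̄ := (1/J)·Σ_{j=1}^J X_j and B̄ := (1/J)·Σ_{j=1}^J B_j, one has |E[-log(1 + X̄)] - (V/J)·(1 + (J - 1)·ρ) - B̄ - B̄²/2| ≤ δ³. -/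
open MeasureTheory

/-- Second-order Taylor bound for `-log (1 + x)` on `[-1/2, 1/2]`. -/
theorem abs_neg_log_one_add_add_sub_sq_le {x : ℝ} (hx : |x| ≤ 1 / 2) :
    |-Real.log (1 + x) + x - x ^ 2 / 2| ≤ |x| ^ 3 := by
  have h := Real.abs_log_sub_add_sum_range_le (x := -x) (by rw [abs_neg]; linarith) 4
  simp only [Finset.sum_range_succ, Finset.sum_range_zero, abs_neg, sub_neg_eq_add] at h
  norm_num at h
  have ht := abs_nonneg x
  have h5 : |x| ^ 5 / (1 - |x|) ≤ |x| ^ 3 / 2 := by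
    rw [div_le_iff₀ (by linarith)]
    have h3 : |x| ^ 3 * |x| ^ 2 ≤ |x| ^ 3 * ((1 - |x|) / 2) := by
      gcongr
      nlinarith
    linarith [show |x| ^ 3 * |x| ^ 2 = |x| ^ 5 by ring]
  have h4 : |x| ^ 4 ≤ |x| ^ 3 / 2 := by
    have := mul_le_mul_of_nonneg_left hx (pow_nonneg ht 3)
    linarith [show |x| ^ 3 * |x| = |x| ^ 4 by ring]
  have h3' : |x ^ 3| ≤ |x| ^ 3 := (abs_pow x 3).le
  have h4' : |x ^ 4| ≤ |x| ^ 4 := (abs_pow x 4).le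
  have e3 : (-x) ^ 3 = -x ^ 3 := by ring
  simp only [e3] at h
  rw [abs_le] at h h3' h4' ⊢
  have := pow_nonneg ht 3
  constructor <;> linarith [h.1, h.2, h3'.1, h3'.2, h4'.1, h4'.2]

/-- Summing a matrix with constant diagonal `a` and constant off-diagonal `b`. -/
theorem sum_sum_eq_of_diag_offDiag {J : ℕ} (C : Fin J → Fin J → ℝ) {a b : ℝ}
    (hdiag : ∀ j, C j j = a) (hoff : ∀ j k, j ≠ k → C j k = b) :
    ∑ j, ∑ k, C j k = J * (a + ((J : ℝ) - 1) * b) := by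
  have h (j k : Fin J) : C j k = b + if j = k then a - b else 0 := by
    split_ifs with hjk
    · subst hjk; rw [hdiag]; ring
    · rw [hoff j k hjk, add_zero]
  simp only [h, Finset.sum_add_distrib, Finset.sum_ite_eq, Finset.mem_univ, if_true,
    Finset.sum_const, Finset.card_univ, Fintype.card_fin, nsmul_eq_mul]
  ring

/-- VPS scaling law (precise form).  Let `X_1, …, X_J` be the per-stream relative
errors, a.s. bounded by `δ ≤ 1/2`, with biases `B_j = -E[X_j]` and centered
residuals `ε_j = X_j + B_j` having common second moment `2V` and common pairwise
cross-moment `2Vρ`.  Then, with `X̄ = (1/J) Σ_j X_j` and `B̄ = (1/J) Σ_j B_j`,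
`|E[-log (1 + X̄)] - (V/J)(1 + (J - 1)ρ) - B̄ - B̄²/2| ≤ δ³`. -/
theorem vps_scaling_law
    {Ω : Type*} [MeasurableSpace Ω] (μ : Measure Ω) [IsProbabilityMeasure μ]
    (J : ℕ) (hJ : 1 ≤ J) (X : Fin J → Ω → ℝ) (hmeas : ∀ j, Measurable (X j))
    (δ : ℝ) (hδ0 : 0 ≤ δ) (hδ : δ ≤ 1 / 2)
    (hbound : ∀ j, ∀ᵐ ω ∂μ, |X j ω| ≤ δ)
    (B : Fin J → ℝ) (hB : ∀ j, B j = -∫ ω, X j ω ∂μ)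
    (ε : Fin J → Ω → ℝ) (hε : ∀ j, ε j = fun ω => X j ω + B j)
    (V : ℝ) (hV0 : 0 ≤ V) (hvar : ∀ j, ∫ ω, (ε j ω) ^ 2 ∂μ = 2 * V)
    (ρ : ℝ) (hcov : ∀ j k, j ≠ k → ∫ ω, ε j ω * ε k ω ∂μ = 2 * V * ρ) :
    |(∫ ω, -Real.log (1 + (1 / (J : ℝ)) * ∑ j, X j ω) ∂μ)
        - (V / (J : ℝ)) * (1 + ((J : ℝ) - 1) * ρ)
        - (1 / (J : ℝ)) * (∑ j, B j)
        - ((1 / (J : ℝ)) * ∑ j, B j) ^ 2 / 2| ≤ δ ^ 3 := by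
  have hJ0 : (0 : ℝ) < J := by exact_mod_cast hJ
  have hX (j : Fin J) : Integrable (X j) μ :=
    .of_bound (hmeas j).aestronglyMeasurable δ (hbound j)
  have hXX (j k : Fin J) : Integrable (fun ω => X j ω * X k ω) μ :=
    (hX k).bdd_mul (hmeas j).aestronglyMeasurable (hbound j)
  have hmean (j : Fin J) : ∫ ω, X j ω ∂μ = -B j := by rw [hB, neg_neg]
  have hprod (j k : Fin J) :
      ∫ ω, X j ω * X k ω ∂μ = (∫ ω, ε j ω * ε k ω ∂μ) + B j * B k := by
    have e : (fun ω => ε j ω * ε k ω) =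
        fun ω => X j ω * X k ω + B k * X j ω + B j * X k ω + B j * B k := by
      funext ω
      simp only [hε]
      ring
    rw [e, integral_add (by fun_prop) (by fun_prop), integral_add (by fun_prop) (by fun_prop),
      integral_add (by fun_prop) (by fun_prop), integral_const_mul, integral_const_mul,
      hmean, hmean]
    simp only [integral_const, probReal_univ, one_smul]
    ring
  set Y : Ω → ℝ := fun ω => (1 / (J : ℝ)) * ∑ j, X j ω with hY
  have hYmeas : Measurable Y := by fun_prop
  have hYbound : ∀ᵐ ω ∂μ, |Y ω| ≤ δ := by
    filter_upwards [ae_all_iff.2 hbound] with ω hω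
    have hsum : |∑ j, X j ω| ≤ J * δ :=
      (Finset.abs_sum_le_sum_abs _ _).trans <|
        (Finset.sum_le_sum fun j _ => hω j).trans (by simp)
    rw [hY, abs_mul, abs_of_pos (by positivity), one_div, inv_mul_le_iff₀ hJ0]
    exact hsum
  have hYint : Integrable Y μ := .of_bound hYmeas.aestronglyMeasurable δ hYbound
  have hYmean : ∫ ω, Y ω ∂μ = -((1 / (J : ℝ)) * ∑ j, B j) := by
    rw [hY, integral_const_mul, integral_finsetSum _ fun j _ => hX j]
    simp only [hmean, Finset.sum_neg_distrib, mul_neg]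
  have hYsq_eq : (fun ω => Y ω ^ 2) =
      fun ω => (1 / (J : ℝ)) ^ 2 * ∑ j, ∑ k, X j ω * X k ω := by
    funext ω
    rw [hY, mul_pow, sq (∑ j, X j ω), Finset.sum_mul_sum]
  have hYsq_int : Integrable (fun ω => Y ω ^ 2) μ := by
    rw [hYsq_eq]
    exact (integrable_finsetSum _ fun j _ => integrable_finsetSum _ fun k _ => hXX j k).const_mul _
  have hYsq : ∫ ω, Y ω ^ 2 ∂μ =
      2 * ((V / J) * (1 + ((J : ℝ) - 1) * ρ)) + ((1 / (J : ℝ)) * ∑ j, B j) ^ 2 := by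
    rw [hYsq_eq, integral_const_mul,
      integral_finsetSum _ fun j _ => integrable_finsetSum _ fun k _ => hXX j k]
    simp only [integral_finsetSum _ fun k _ => hXX _ k, hprod, Finset.sum_add_distrib]
    rw [sum_sum_eq_of_diag_offDiag (fun j k => ∫ ω, ε j ω * ε k ω ∂μ)
      (fun j => by simpa only [sq] using hvar j) hcov, ← Finset.sum_mul_sum]
    field_simp
  have hTaylor : ∀ᵐ ω ∂μ, ‖-Real.log (1 + Y ω) + Y ω - Y ω ^ 2 / 2‖ ≤ δ ^ 3 := by
    filter_upwards [hYbound] with ω hω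
    exact (abs_neg_log_one_add_add_sub_sq_le (hω.trans hδ)).trans
      (pow_le_pow_left₀ (abs_nonneg _) hω 3)
  have hR : Integrable (fun ω => -Real.log (1 + Y ω) + Y ω - Y ω ^ 2 / 2) μ :=
    .of_bound (by fun_prop) _ hTaylor
  have hlog : ∫ ω, -Real.log (1 + Y ω) ∂μ =
      (∫ ω, (-Real.log (1 + Y ω) + Y ω - Y ω ^ 2 / 2) ∂μ) - (∫ ω, Y ω ∂μ)
        + (∫ ω, Y ω ^ 2 ∂μ) / 2 := by
    rw [← integral_div, ← integral_sub hR hYint,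
      ← integral_add (by fun_prop) (hYsq_int.div_const 2)]
    congr 1
    funext ω
    ring
  have hfinal := norm_integral_le_of_norm_le_const hTaylor
  rw [probReal_univ, mul_one, Real.norm_eq_abs] at hfinal
  rw [hlog, hYmean, hYsq]
  convert hfinal using 2
  ring
end
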